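/- For every pointed model M_s and every pointed action model 𝖬_𝗌 with M_s ⊨ pre(𝗌), the pointed model (M ⊗ 𝖬)_{(s,𝗌)} resulting from executing 𝖬_𝗌 in M_s is a refinement of M_s, i.e. M_s ⪰ (M ⊗ 𝖬)_{(s,𝗌)}. -/

import Mathlib

/-- A Kripke model over agents `A` and propositional variables `P`. -/
structure KModel (A P : Type) where
  S : Type
  R : A → S → S → Prop
  V : P → S → Prop

/-- `Refines B M s N t`: there is a `B`-refinement from `M_s` to `N_t`. -/
def Refines {A P : Type} (B : Set A) (M : KModel A P) (s : M.S)
    (N : KModel A P) (t : N.S) : Prop :=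
  ∃ Z : M.S → N.S → Prop,
    Z s t ∧
    (∀ u v, Z u v → ∀ p, M.V p u ↔ N.V p v) ∧
    (∀ a : A, ∀ u v, Z u v → ∀ v', N.R a v v' → ∃ u', M.R a u u' ∧ Z u' v') ∧
    (∀ a : A, a ∉ B → ∀ u v, Z u v → ∀ u', M.R a u u' → ∃ v', N.R a v v' ∧ Z u' v')

/-- The basic multi-agent modal language `L`. -/
inductive Form (A P : Type) : Type where
  | atom : P → Form A P
  | neg : Form A P → Form A P
  | and : Form A P → Form A P → Form A P
  | box : A → Form A P → Form A P

/-- Standard Kripke satisfaction for the basic modal language. -/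
def FSat {A P : Type} (M : KModel A P) : M.S → Form A P → Prop
  | s, .atom p => M.V p s
  | s, .neg φ => ¬ FSat M s φ
  | s, .and φ ψ => FSat M s φ ∧ FSat M s ψ
  | s, .box a φ => ∀ t, M.R a s t → FSat M t φ

/-- An action model: action points with accessibility relations and preconditions. -/
structure ActModel (A P : Type) where
  S : Type
  R : A → S → S → Prop
  pre : S → Form A P

/-- The restricted modal product `M ⊗ 𝖬`. -/
def AProd {A P : Type} (M : KModel A P) (E : ActModel A P) : KModel A P where
  S := { x : M.S × E.S // FSat M x.1 (E.pre x.2) }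
  R := fun a x y => M.R a x.1.1 y.1.1 ∧ E.R a x.1.2 y.1.2
  V := fun p x => M.V p x.1.1

/-- Executing an epistemic action `𝖬_𝗌` in a pointed model `M_s` (with `M_s ⊨ pre(𝗌)`)
yields a refinement of `M_s`: `M_s ⪰ (M ⊗ 𝖬)_{(s,𝗌)}`. -/
theorem product_is_refinement {A P : Type} (M : KModel A P) (s : M.S)
    (E : ActModel A P) (e : E.S) (h : FSat M s (E.pre e)) :
    Refines (Set.univ : Set A) M s (AProd M E) ⟨(s, e), h⟩ := by
  refine ⟨fun u v => v.1.1 = u, rfl, ?_, ?_, fun a ha => absurd (Set.mem_univ a) ha⟩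
  · rintro _ v rfl p
    exact Iff.rfl
  · rintro a _ v rfl v' hv
    exact ⟨v'.1.1, hv.1, rfl⟩
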